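/- arXiv:1910.06942 — 3 statements merged into one kernel-verified Lean document; each statement's English description precedes it below -/
import Mathlib

section
/- Let N be a positive integer, k an even integer, and f : ℍ → ℂ a function transforming like a modular form of weight k for Γ₀(N). Let Q and Q′ be exact divisors of N with gcd(Q, Q′) = 1 (so that Q·Q′ is again an exact divisor of N), and let W_Q, W_{Q′}, W_{QQ′} be any Atkin-Lehner matrices at level N for Q, Q′, and QQ′ respectively. Then (f∣ₖW_Q)∣ₖW_{Q′} = (f∣ₖW_{Q′})∣ₖW_Q = f∣ₖW_{QQ′}. -/
noncomputable section

open Complex Matrix Finset UpperHalfPlane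

/-- Möbius action of a real `2×2` matrix on the upper half-plane (this is the genuine
Möbius action `τ ↦ (aτ+b)/(cτ+d)` whenever the matrix has positive determinant). -/
def moebius (g : Matrix (Fin 2) (Fin 2) ℝ) (τ : UpperHalfPlane) : UpperHalfPlane :=
  if h : 0 < ((((g 0 0 : ℝ) : ℂ) * (τ : ℂ) + ((g 0 1 : ℝ) : ℂ)) /
      (((g 1 0 : ℝ) : ℂ) * (τ : ℂ) + ((g 1 1 : ℝ) : ℂ))).im then
    UpperHalfPlane.mk _ h else τ

/-- The weight-`k` slash action of a real `2×2` matrix, normalized with `det ^ (k/2)`. -/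
def slash (k : ℤ) (g : Matrix (Fin 2) (Fin 2) ℝ) (f : UpperHalfPlane → ℂ) :
    UpperHalfPlane → ℂ :=
  fun τ => ((g.det : ℝ) : ℂ) ^ ((k : ℂ) / 2) *
    (((g 1 0 : ℝ) : ℂ) * (τ : ℂ) + ((g 1 1 : ℝ) : ℂ)) ^ (-k) * f (moebius g τ)

/-- `g` is (the image in `SL₂(ℝ)` of) an integer matrix of determinant `1` whose
lower-left entry is divisible by `N`, i.e. an element of `Γ₀(N)`. -/
def MemGamma0 (N : ℕ) (g : Matrix (Fin 2) (Fin 2) ℝ) : Prop :=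
  (∃ a b c d : ℤ, g = !![(a : ℝ), (b : ℝ); (c : ℝ), (d : ℝ)] ∧ (N : ℤ) ∣ c) ∧ g.det = 1

/-- `f` transforms like a modular form of weight `k` for `Γ₀(N)`. -/
def TransformsLike (N : ℕ) (k : ℤ) (f : UpperHalfPlane → ℂ) : Prop :=
  ∀ g, MemGamma0 N g → slash k g f = f

/-- An Atkin-Lehner matrix for the exact divisor `Q` at level `N`:
`W_Q = (1/√Q)·(Qx, y; Nz, Qt)` with integer entries and determinant `1`. -/
def IsAtkinLehner (N Q : ℕ) (W : Matrix (Fin 2) (Fin 2) ℝ) : Prop :=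
  (∃ x y z t : ℤ,
      W = (Real.sqrt Q)⁻¹ • !![(Q : ℝ) * x, (y : ℝ); (N : ℝ) * z, (Q : ℝ) * t]) ∧
    W.det = 1

/-- The matrix `B_m = (1/√m)·(m, 0; 0, 1)`. -/
def Bmat (m : ℕ) : Matrix (Fin 2) (Fin 2) ℝ :=
  (Real.sqrt m)⁻¹ • !![(m : ℝ), 0; 0, 1]

/-- The `m`-th Hecke operator of weight `k` and level `N`:
`(f∣T_m)(τ) = m^{k/2−1} Σ_{ad = m, gcd(a,N)=1} Σ_{b=0}^{d−1} (f∣ₖ(a, b; 0, d))(τ)`. -/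
def hecke (N : ℕ) (k : ℤ) (m : ℕ) (f : UpperHalfPlane → ℂ) : UpperHalfPlane → ℂ :=
  fun τ => (m : ℂ) ^ ((k : ℂ) / 2 - 1) *
    ∑ a ∈ m.divisors, if Nat.gcd a N = 1 then
      ∑ b ∈ Finset.range (m / a), slash k !![(a : ℝ), (b : ℝ); 0, ((m / a : ℕ) : ℝ)] f τ
    else 0

/-- The weight-`0` operator `U_m`: `(f∣U_m)(τ) = (1/m) Σ_{j=0}^{m−1} f((τ+j)/m)`. -/
def U0 (m : ℕ) (f : UpperHalfPlane → ℂ) : UpperHalfPlane → ℂ :=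
  fun τ => (1 / (m : ℂ)) * ∑ j ∈ Finset.range m, f (moebius !![1, (j : ℝ); 0, (m : ℝ)] τ)

/-- The weight-`0` operator `B_m`: `(f∣B_m)(τ) = f(mτ)`. -/
def B0 (m : ℕ) (f : UpperHalfPlane → ℂ) : UpperHalfPlane → ℂ :=
  fun τ => f (moebius !![(m : ℝ), 0; 0, 1] τ)

/-- The weight-`0` action of a matrix: `(f∣W)(τ) = f(W·τ)`. -/
def W0 (W : Matrix (Fin 2) (Fin 2) ℝ) (f : UpperHalfPlane → ℂ) : UpperHalfPlane → ℂ :=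
  fun τ => f (moebius W τ)

/-- `f` is invariant under `Γ₀(N)` in weight `0`. -/
def Inv0 (N : ℕ) (f : UpperHalfPlane → ℂ) : Prop :=
  ∀ g, MemGamma0 N g → ∀ τ, f (moebius g τ) = f τ

lemma moebius_denom_ne_zero {g : Matrix (Fin 2) (Fin 2) ℝ} (hg : 0 < g.det) (τ : UpperHalfPlane) :
    ((g 1 0 : ℝ) : ℂ) * (τ : ℂ) + ((g 1 1 : ℝ) : ℂ) ≠ 0 := by
  intro h
  have him := congrArg Complex.im h
  have hre := congrArg Complex.re h
  simp only [Complex.add_im, Complex.mul_im, Complex.ofReal_re, Complex.ofReal_im, zero_mul,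
    add_zero, Complex.zero_im, mul_eq_zero, UpperHalfPlane.coe_im, τ.im_ne_zero, or_false] at him
  rw [Matrix.det_fin_two] at hg
  simp [him] at hre
  simp [him, hre] at hg

lemma coe_moebius {g : Matrix (Fin 2) (Fin 2) ℝ} (hg : 0 < g.det) (τ : UpperHalfPlane) :
    (moebius g τ : ℂ) = (((g 0 0 : ℝ) : ℂ) * (τ : ℂ) + ((g 0 1 : ℝ) : ℂ)) /
      (((g 1 0 : ℝ) : ℂ) * (τ : ℂ) + ((g 1 1 : ℝ) : ℂ)) := by
  have hpos : 0 < ((((g 0 0 : ℝ) : ℂ) * (τ : ℂ) + ((g 0 1 : ℝ) : ℂ)) /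
      (((g 1 0 : ℝ) : ℂ) * (τ : ℂ) + ((g 1 1 : ℝ) : ℂ))).im := by
    have hden := Complex.normSq_pos.mpr (moebius_denom_ne_zero hg τ)
    have heq : ((((g 0 0 : ℝ) : ℂ) * (τ : ℂ) + ((g 0 1 : ℝ) : ℂ)) /
        (((g 1 0 : ℝ) : ℂ) * (τ : ℂ) + ((g 1 1 : ℝ) : ℂ))).im = g.det * τ.im /
        Complex.normSq (((g 1 0 : ℝ) : ℂ) * (τ : ℂ) + ((g 1 1 : ℝ) : ℂ)) := by
      rw [Complex.div_im, ← sub_div, Matrix.det_fin_two]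
      simp
      ring
    rw [heq]
    exact div_pos (mul_pos hg τ.im_pos) hden
  rw [moebius, dif_pos hpos]

lemma moebius_row_mul (g : Matrix (Fin 2) (Fin 2) ℝ) {h : Matrix (Fin 2) (Fin 2) ℝ}
    (hh : 0 < h.det) (τ : UpperHalfPlane) (i : Fin 2) :
    (((g * h) i 0 : ℝ) : ℂ) * (τ : ℂ) + (((g * h) i 1 : ℝ) : ℂ) =
      (((g i 0 : ℝ) : ℂ) * (moebius h τ : ℂ) + ((g i 1 : ℝ) : ℂ)) *
        (((h 1 0 : ℝ) : ℂ) * (τ : ℂ) + ((h 1 1 : ℝ) : ℂ)) := by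
  rw [coe_moebius hh, add_mul, mul_assoc, div_mul_cancel₀ _ (moebius_denom_ne_zero hh τ)]
  simp only [Matrix.mul_apply, Fin.sum_univ_two]
  push_cast
  ring

lemma moebius_mul {g h : Matrix (Fin 2) (Fin 2) ℝ} (hg : 0 < g.det) (hh : 0 < h.det)
    (τ : UpperHalfPlane) : moebius (g * h) τ = moebius g (moebius h τ) := by
  have hgh : 0 < (g * h).det := by rw [Matrix.det_mul]; exact mul_pos hg hh
  apply UpperHalfPlane.ext
  rw [coe_moebius hgh, coe_moebius hg, moebius_row_mul g hh, moebius_row_mul g hh,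
    mul_div_mul_right _ _ (moebius_denom_ne_zero hh τ)]

lemma slash_mul (k : ℤ) {g h : Matrix (Fin 2) (Fin 2) ℝ} (hg : g.det = 1) (hh : h.det = 1)
    (f : UpperHalfPlane → ℂ) : slash k (g * h) f = slash k h (slash k g f) := by
  have hg' : 0 < g.det := hg ▸ one_pos
  have hh' : 0 < h.det := hh ▸ one_pos
  funext τ
  simp only [slash, moebius_row_mul g hh', moebius_mul hg' hh', Matrix.det_mul, hg, hh,
    mul_one, Complex.ofReal_one, Complex.one_cpow, one_mul, mul_zpow]
  ring

lemma IsAtkinLehner.mul {N Q Q' : ℕ} {W W' : Matrix (Fin 2) (Fin 2) ℝ}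
    (hN : Q * Q' ∣ N) (hW : IsAtkinLehner N Q W) (hW' : IsAtkinLehner N Q' W') :
    IsAtkinLehner N (Q * Q') (W * W') := by
  obtain ⟨M, rfl⟩ := hN
  obtain ⟨⟨x, y, z, t, rfl⟩, hd⟩ := hW
  obtain ⟨⟨x', y', z', t', rfl⟩, hd'⟩ := hW'
  refine ⟨⟨x * x' + M * y * z', Q * x * y' + Q' * y * t', z * Q' * x' + Q * t * z',
    M * z * y' + t * t', ?_⟩, by rw [Matrix.det_mul, hd, hd', mul_one]⟩
  rw [Matrix.smul_mul, Matrix.mul_smul, smul_smul, Nat.cast_mul Q Q',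
    Real.sqrt_mul (Nat.cast_nonneg Q), mul_inv]
  congr 1
  ext i j
  fin_cases i <;> fin_cases j <;> simp [Matrix.mul_apply, Fin.sum_univ_two] <;> ring

/-- Two Atkin-Lehner matrices for the same divisor differ by an element of `Γ₀(N)`. -/
lemma IsAtkinLehner.memGamma0_mul_adjugate {N R : ℕ} {W W' : Matrix (Fin 2) (Fin 2) ℝ}
    (hR : 0 < R) (hN : R ∣ N) (hW : IsAtkinLehner N R W) (hW' : IsAtkinLehner N R W') :
    MemGamma0 N (W * W'.adjugate) := by
  refine ⟨?_, by rw [Matrix.det_mul, Matrix.det_adjugate, hW.2, hW'.2]; simp⟩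
  obtain ⟨M, rfl⟩ := hN
  obtain ⟨⟨x, y, z, t, rfl⟩, -⟩ := hW
  obtain ⟨⟨x', y', z', t', rfl⟩, -⟩ := hW'
  refine ⟨R * x * t' - M * y * z', y * x' - x * y', (R * M : ℕ) * (z * t' - t * z'),
    R * t * x' - M * z * y', ?_, dvd_mul_right _ _⟩
  have hR' : (R : ℝ) ≠ 0 := by positivity
  have hs : (Real.sqrt R)⁻¹ * (Real.sqrt R)⁻¹ = (R : ℝ)⁻¹ := by
    rw [← mul_inv, Real.mul_self_sqrt (Nat.cast_nonneg R)]
  rw [Matrix.adjugate_smul, Fintype.card_fin, pow_one, Matrix.smul_mul, Matrix.mul_smul, smul_smul,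
    hs, Matrix.adjugate_fin_two_of]
  ext i j
  fin_cases i <;> fin_cases j <;> simp <;>
    field_simp <;> ring

lemma TransformsLike.slash_eq_slash {N R : ℕ} {k : ℤ} {f : UpperHalfPlane → ℂ}
    (hf : TransformsLike N k f) (hR : 0 < R) (hN : R ∣ N) {W W' : Matrix (Fin 2) (Fin 2) ℝ}
    (hW : IsAtkinLehner N R W) (hW' : IsAtkinLehner N R W') : slash k W f = slash k W' f := by
  have hγ := hW.memGamma0_mul_adjugate hR hN hW'
  have hprod : W * W'.adjugate * W' = W := by
    rw [Matrix.mul_assoc, Matrix.adjugate_mul, hW'.2, one_smul, Matrix.mul_one]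
  rw [← hprod, slash_mul k hγ.2 hW'.2, hf _ hγ]

/-- For coprime exact divisors `Q, Q′` of `N` and `f` transforming like
a modular form of even weight `k` for `Γ₀(N)`, one has
`(f∣ₖW_Q)∣ₖW_{Q′} = (f∣ₖW_{Q′})∣ₖW_Q = f∣ₖW_{QQ′}`. -/
theorem atkinLehner_mul (N : ℕ) (hN : 0 < N) (k : ℤ) (hk : Even k)
    (f : UpperHalfPlane → ℂ) (hf : TransformsLike N k f)
    (Q Q' : ℕ) (hQ : Q ∣ N) (hQe : Nat.gcd Q (N / Q) = 1)
    (hQ' : Q' ∣ N) (hQ'e : Nat.gcd Q' (N / Q') = 1) (hQQ' : Nat.gcd Q Q' = 1)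
    (WQ WQ' WQQ' : Matrix (Fin 2) (Fin 2) ℝ)
    (hWQ : IsAtkinLehner N Q WQ) (hWQ' : IsAtkinLehner N Q' WQ')
    (hWQQ' : IsAtkinLehner N (Q * Q') WQQ') :
    slash k WQ' (slash k WQ f) = slash k WQ (slash k WQ' f) ∧
      slash k WQ' (slash k WQ f) = slash k WQQ' f := by
  have hdvd : Q * Q' ∣ N := Nat.Coprime.mul_dvd_of_dvd_of_dvd hQQ' hQ hQ'
  have hpos : 0 < Q * Q' := Nat.pos_of_dvd_of_pos hdvd hN
  have hmul := hWQ.mul hdvd hWQ'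
  have hmul' : IsAtkinLehner N (Q * Q') (WQ' * WQ) := by
    rw [mul_comm Q Q'] at hdvd ⊢
    exact hWQ'.mul hdvd hWQ
  rw [← slash_mul k hWQ.2 hWQ'.2, ← slash_mul k hWQ'.2 hWQ.2]
  exact ⟨hf.slash_eq_slash hpos hdvd hmul hmul', hf.slash_eq_slash hpos hdvd hmul hWQQ'⟩
end
end

section
/- Let N be a positive integer, p a prime exactly dividing N (p ∣ N, p ∤ N/p), and f : ℍ → ℂ a function invariant under Γ₀(N) in weight 0 (i.e. f(γ·τ) = f(τ) for all γ ∈ Γ₀(N)). Define (g∣U_p)(τ) = (1/p) Σ_{j=0}^{p−1} g((τ+j)/p), and for an Atkin-Lehner matrix W_p for p at level N define (g∣W_p)(τ) = g(W_p·τ). Then the function f + p·((f∣W_p)∣U_p) is invariant under Γ₀(N/p) in weight 0. -/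
noncomputable section

open Complex Matrix Finset UpperHalfPlane

theorem sum_smul_invariant {G X ι : Type*} [Group G] [MulAction G X] [Fintype ι]
    (H : Subgroup G) (K : Subgroup G) (R : ι → G) (hRK : ∀ i, R i ∈ K)
    (hex : ∀ g ∈ K, ∃ i, g * (R i)⁻¹ ∈ H)
    (huniq : ∀ i j, R i * (R j)⁻¹ ∈ H → i = j)
    (f : X → ℂ) (hf : ∀ h ∈ H, ∀ x, f (h • x) = f x) (g : G) (hg : g ∈ K) (x : X) :
    ∑ i, f (R i • g • x) = ∑ i, f (R i • x) := by
  choose σ hσ using fun i => hex (R i * g) (K.mul_mem (hRK i) hg)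
  have hinj : Function.Injective σ := by
    intro i j hij
    have h := H.mul_mem (hσ i) (H.inv_mem (hσ j))
    rw [hij] at h
    exact huniq i j (by simpa [mul_assoc] using h)
  refine Fintype.sum_bijective σ (Finite.injective_iff_bijective.mp hinj) _ _ fun i => ?_
  rw [← hf _ (hσ i) (R (σ i) • x), ← mul_smul, ← mul_smul, inv_mul_cancel_right]

theorem moebius_eq_of_coe_eq {g : Matrix (Fin 2) (Fin 2) ℝ} {τ z : UpperHalfPlane}
    (h : (z : ℂ) = (((g 0 0 : ℝ) : ℂ) * (τ : ℂ) + ((g 0 1 : ℝ) : ℂ)) /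
      (((g 1 0 : ℝ) : ℂ) * (τ : ℂ) + ((g 1 1 : ℝ) : ℂ))) : moebius g τ = z := by
  have him : 0 < ((((g 0 0 : ℝ) : ℂ) * (τ : ℂ) + ((g 0 1 : ℝ) : ℂ)) /
      (((g 1 0 : ℝ) : ℂ) * (τ : ℂ) + ((g 1 1 : ℝ) : ℂ))).im := by
    rw [← h]; exact z.im_pos
  rw [moebius, dif_pos him]
  exact UpperHalfPlane.ext h.symm

theorem moebius_intMatrix (A : SpecialLinearGroup (Fin 2) ℤ) (τ : UpperHalfPlane) :
    moebius !![(A 0 0 : ℝ), (A 0 1 : ℝ); (A 1 0 : ℝ), (A 1 1 : ℝ)] τ = A • τ := by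
  apply moebius_eq_of_coe_eq
  rw [UpperHalfPlane.specialLinearGroup_apply]
  simp

theorem mul_inv_one_zero (A B : SpecialLinearGroup (Fin 2) ℤ) :
    (A * B⁻¹) 1 0 = A 1 0 * B 1 1 - A 1 1 * B 1 0 := by
  simp [Matrix.mul_apply, adjugate_fin_two, sub_eq_add_neg]

theorem mem_Gamma0_iff_dvd {N : ℕ} {A : SpecialLinearGroup (Fin 2) ℤ} :
    A ∈ CongruenceSubgroup.Gamma0 N ↔ (N : ℤ) ∣ A 1 0 := by
  rw [CongruenceSubgroup.Gamma0_mem, ZMod.intCast_zmod_eq_zero_iff_dvd]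

theorem memGamma0_intMatrix {N : ℕ} {A : SpecialLinearGroup (Fin 2) ℤ}
    (hA : A ∈ CongruenceSubgroup.Gamma0 N) :
    MemGamma0 N !![(A 0 0 : ℝ), (A 0 1 : ℝ); (A 1 0 : ℝ), (A 1 1 : ℝ)] := by
  refine ⟨⟨_, _, _, _, rfl, mem_Gamma0_iff_dvd.mp hA⟩, ?_⟩
  have h := A.det_coe
  rw [det_fin_two] at h
  rw [det_fin_two_of]
  exact_mod_cast h

theorem MemGamma0.exists_intMatrix {N : ℕ} {g : Matrix (Fin 2) (Fin 2) ℝ} (hg : MemGamma0 N g) :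
    ∃ A ∈ CongruenceSubgroup.Gamma0 N,
      g = !![(A 0 0 : ℝ), (A 0 1 : ℝ); (A 1 0 : ℝ), (A 1 1 : ℝ)] := by
  obtain ⟨⟨a, b, c, d, rfl, hc⟩, hdet⟩ := hg
  rw [det_fin_two_of] at hdet
  have h : (!![a, b; c, d]).det = 1 := by
    rw [det_fin_two_of]
    exact_mod_cast hdet
  exact ⟨⟨!![a, b; c, d], h⟩, mem_Gamma0_iff_dvd.mpr hc, rfl⟩

theorem inv0_iff_smul {N : ℕ} {f : UpperHalfPlane → ℂ} :
    Inv0 N f ↔ ∀ A ∈ CongruenceSubgroup.Gamma0 N, ∀ τ, f (A • τ) = f τ := by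
  constructor
  · intro hf A hA τ
    rw [← moebius_intMatrix]
    exact hf _ (memGamma0_intMatrix hA) τ
  · intro hf g hg τ
    obtain ⟨A, hA, rfl⟩ := hg.exists_intMatrix
    rw [moebius_intMatrix]
    exact hf A hA τ

/-- Representatives of `Γ₀(pM) \ Γ₀(M)`: the identity, and the products of
`(px, y; pMz, pt)` with `(1, j; 0, p)`, divided by `p`. -/
def cosetRep {M p : ℕ} {x y z t : ℤ} (h : p * x * t - M * z * y = 1) :
    Option (Fin p) → SpecialLinearGroup (Fin 2) ℤ
  | none => 1
  | some j => ⟨!![x, x * j + y; M * z, M * z * j + p * t], by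
      rw [det_fin_two_of]; linear_combination h⟩

theorem not_dvd_of_det_eq_one {M p : ℕ} {x y z t : ℤ} (h : p * x * t - M * z * y = 1)
    (hp : p.Prime) : ¬ (p : ℤ) ∣ M * z := by
  rintro ⟨k, hk⟩
  refine (Nat.prime_iff_prime_int.mp hp).not_dvd_one ⟨x * t - k * y, ?_⟩
  linear_combination -h - y * hk

section CosetRep

variable {M p : ℕ} {x y z t : ℤ} (h : p * x * t - M * z * y = 1)

theorem cosetRep_mem (i : Option (Fin p)) : cosetRep h i ∈ CongruenceSubgroup.Gamma0 M := by
  cases i with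
  | none => exact Subgroup.one_mem _
  | some j => exact mem_Gamma0_iff_dvd.mpr ⟨z, rfl⟩

theorem exists_mul_cosetRep_inv_mem (hp : p.Prime) (hpM : ¬ p ∣ M)
    {A : SpecialLinearGroup (Fin 2) ℤ} (hA : A ∈ CongruenceSubgroup.Gamma0 M) :
    ∃ i, A * (cosetRep h i)⁻¹ ∈ CongruenceSubgroup.Gamma0 (p * M) := by
  have : Fact p.Prime := ⟨hp⟩
  have hcop : IsCoprime (p : ℤ) M :=
    Nat.isCoprime_iff_coprime.mpr ((Nat.Prime.coprime_iff_not_dvd hp).mpr hpM)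
  rw [mem_Gamma0_iff_dvd] at hA
  by_cases hc : (p : ℤ) ∣ A 1 0
  · refine ⟨none, mem_Gamma0_iff_dvd.mpr ?_⟩
    simpa [cosetRep] using hcop.mul_dvd hc hA
  · have hc0 : ((A 1 0 : ℤ) : ZMod p) ≠ 0 := fun h0 =>
      hc ((ZMod.intCast_zmod_eq_zero_iff_dvd _ _).mp h0)
    let j : ZMod p := (A 1 1 : ZMod p) * (A 1 0 : ZMod p)⁻¹
    refine ⟨some ⟨j.val, ZMod.val_lt j⟩, mem_Gamma0_iff_dvd.mpr ?_⟩
    have hj : (p : ℤ) ∣ A 1 0 * (j.val : ℤ) - A 1 1 := by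
      rw [← ZMod.intCast_zmod_eq_zero_iff_dvd]
      push_cast
      rw [ZMod.natCast_zmod_val]
      simp only [j]
      field_simp
      ring
    have hentry : (A * (cosetRep h (some ⟨j.val, ZMod.val_lt j⟩))⁻¹) 1 0 =
        A 1 0 * (M * z * (j.val : ℤ) + p * t) - A 1 1 * (M * z) := mul_inv_one_zero _ _
    rw [hentry]
    push_cast
    refine hcop.mul_dvd ?_ ?_
    · obtain ⟨k, hk⟩ := hj
      exact ⟨M * z * k + A 1 0 * t, by linear_combination M * z * hk⟩
    · exact dvd_sub (hA.mul_right _) ⟨A 1 1 * z, by ring⟩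

theorem cosetRep_unique (hp : p.Prime) (i j : Option (Fin p))
    (hij : cosetRep h i * (cosetRep h j)⁻¹ ∈ CongruenceSubgroup.Gamma0 (p * M)) : i = j := by
  have hnd := not_dvd_of_det_eq_one h hp
  have hdvd : (p : ℤ) ∣ (cosetRep h i * (cosetRep h j)⁻¹) 1 0 :=
    (Dvd.intro (M : ℤ) (by push_cast; rfl)).trans (mem_Gamma0_iff_dvd.mp hij)
  rw [mul_inv_one_zero] at hdvd
  cases i with
  | none =>
    cases j with
    | none => rfl
    | some j => exact absurd (by simpa [cosetRep] using hdvd) hnd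
  | some i =>
    cases j with
    | none => exact absurd (by simpa [cosetRep] using hdvd) hnd
    | some j =>
      have hpr := Nat.prime_iff_prime_int.mp hp
      have hmul : (p : ℤ) ∣ M * z * (M * z) * ((j : ℤ) - i) := by
        convert hdvd using 1
        simp only [cosetRep, of_apply, cons_val', cons_val_zero, cons_val_one, cons_val_fin_one]
        ring
      have hsub : (p : ℤ) ∣ (j : ℤ) - i :=
        (hpr.dvd_or_dvd hmul).resolve_left fun hsq => (hpr.dvd_or_dvd hsq).elim hnd hnd
      have hmod : (i : ℕ) ≡ j [MOD p] := (Nat.modEq_iff_dvd).mpr hsub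
      exact congrArg some (Fin.ext (hmod.eq_of_lt_of_lt i.isLt j.isLt))

theorem moebius_moebius_eq_cosetRep_smul (hp : 0 < p) (j : Fin p) (τ : UpperHalfPlane) :
    moebius ((Real.sqrt p)⁻¹ • !![(p : ℝ) * x, (y : ℝ); ((p * M : ℕ) : ℝ) * z, (p : ℝ) * t])
      (moebius !![1, (j : ℝ); 0, (p : ℝ)] τ) = cosetRep h (some j) • τ := by
  have hpC : (p : ℂ) ≠ 0 := by exact_mod_cast hp.ne'
  have him : 0 < (((τ : ℂ) + (j : ℕ)) / (p : ℂ)).im := by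
    have := τ.im_pos
    rw [Complex.div_natCast_im]
    simp only [Complex.add_im, Complex.natCast_im, add_zero]
    positivity
  have hinner : moebius !![1, (j : ℝ); 0, (p : ℝ)] τ = UpperHalfPlane.mk _ him :=
    moebius_eq_of_coe_eq (by simp)
  have hs : (((Real.sqrt p)⁻¹ : ℝ) : ℂ) ≠ 0 := by
    have : (0 : ℝ) < p := by exact_mod_cast hp
    exact_mod_cast (inv_pos.mpr (Real.sqrt_pos.mpr this)).ne'
  rw [hinner]
  apply moebius_eq_of_coe_eq
  rw [UpperHalfPlane.specialLinearGroup_apply]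
  simp only [cosetRep, smul_of, smul_cons, smul_eq_mul, of_apply, cons_val', cons_val_zero,
    cons_val_one, cons_val_fin_one, Complex.ofReal_mul, mul_assoc, ← mul_add,
    mul_div_mul_left _ _ hs]
  push_cast
  congr 1
  · simp
    field_simp
    ring
  · simp
    field_simp
    ring

end CosetRep

/-- For `p` a prime exactly dividing `N`, `f` weight-`0` invariant under
`Γ₀(N)`, and `W_p` an Atkin-Lehner matrix for `p` at level `N`, the function
`f + p·((f∣W_p)∣U_p)` is weight-`0` invariant under `Γ₀(N/p)`. -/
theorem add_p_mul_Wp_Up_invariant (N : ℕ) (hN : 0 < N) (p : ℕ) (hp : p.Prime)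
    (hpN : p ∣ N) (hpe : ¬ p ∣ N / p)
    (f : UpperHalfPlane → ℂ) (hf : Inv0 N f)
    (W : Matrix (Fin 2) (Fin 2) ℝ) (hW : IsAtkinLehner N p W) :
    Inv0 (N / p) (fun τ => f τ + (p : ℂ) * U0 p (W0 W f) τ) := by
  obtain ⟨M, rfl⟩ := hpN
  rw [Nat.mul_div_cancel_left _ hp.pos] at hpe ⊢
  obtain ⟨⟨x, y, z, t, rfl⟩, hdet⟩ := hW
  have hpR : (0 : ℝ) < p := by exact_mod_cast hp.pos
  have hdet' : (p : ℤ) * x * t - M * z * y = 1 := by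
    have hsq : ((Real.sqrt p)⁻¹) ^ 2 = (p : ℝ)⁻¹ := by
      rw [inv_pow, Real.sq_sqrt hpR.le]
    rw [det_smul, Fintype.card_fin, hsq, det_fin_two_of] at hdet
    field_simp at hdet
    push_cast at hdet
    have : (p : ℝ) * x * t - M * z * y = 1 := by
      apply mul_left_cancel₀ hpR.ne'
      linear_combination hdet
    exact_mod_cast this
  have htrace : ∀ τ, f τ + (p : ℂ) * U0 p (W0 ((Real.sqrt p)⁻¹ •
      !![(p : ℝ) * x, (y : ℝ); ((p * M : ℕ) : ℝ) * z, (p : ℝ) * t]) f) τ =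
      ∑ i, f (cosetRep hdet' i • τ) := by
    intro τ
    have hpC : (p : ℂ) ≠ 0 := by exact_mod_cast hp.ne_zero
    rw [Fintype.sum_option, U0, ← mul_assoc, mul_one_div_cancel hpC, one_mul,
      Finset.sum_range]
    congr 1
    · simp [cosetRep]
    · exact Finset.sum_congr rfl fun j _ =>
        congrArg f (moebius_moebius_eq_cosetRep_smul hdet' hp.pos j τ)
  rw [inv0_iff_smul] at hf ⊢
  intro A hA τ
  simp only [htrace]
  exact sum_smul_invariant _ _ _ (cosetRep_mem hdet')
    (fun _ hB => exists_mul_cosetRep_inv_mem hdet' hp hpe hB)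
    (cosetRep_unique hdet' hp) f hf A hA τ
end
end

section
/- Let N, c, ν, n be positive integers. Then every positive integer e dividing each of N·c, ν, and n can be written in exactly one way as a product e = d·t of positive integers d, t such that d divides gcd(N, ν, n), t divides c, t divides ν/d, t divides n/d, and gcd(t, N/d) = 1. -/
noncomputable section

open Complex Matrix Finset UpperHalfPlane

/-- Every positive common divisor `e` of `N·c`, `ν`, `n` factors
uniquely as `e = d·t` with `d` a common divisor of `N, ν, n` and `t` a common divisor of
`c, ν/d, n/d` that is coprime to `N/d`. -/
theorem unique_factorization_common_divisor (N c ν n : ℕ)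
    (hN : 0 < N) (hc : 0 < c) (hν : 0 < ν) (hn : 0 < n)
    (e : ℕ) (he : 0 < e) (heNc : e ∣ N * c) (heν : e ∣ ν) (hen : e ∣ n) :
    ∃! dt : ℕ × ℕ, 0 < dt.1 ∧ 0 < dt.2 ∧ e = dt.1 * dt.2 ∧
      dt.1 ∣ Nat.gcd N (Nat.gcd ν n) ∧ dt.2 ∣ c ∧ dt.2 ∣ ν / dt.1 ∧ dt.2 ∣ n / dt.1 ∧
      Nat.gcd dt.2 (N / dt.1) = 1 := by
  have hd : 0 < Nat.gcd e N := Nat.gcd_pos_of_pos_left N he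
  obtain ⟨t, M, hco, het, hNM⟩ := Nat.exists_coprime e N
  set d := Nat.gcd e N
  rw [mul_comm t] at het
  rw [mul_comm M] at hNM
  have ht : 0 < t := Nat.pos_of_mul_pos_left (het ▸ he)
  have hdtν : d * t ∣ ν := het ▸ heν
  have hdtn : d * t ∣ n := het ▸ hen
  refine ⟨(d, t), ⟨hd, ht, het, ?_, ?_, ?_, ?_, ?_⟩, ?_⟩
  · exact Nat.dvd_gcd (Nat.gcd_dvd_right e N)
      (Nat.dvd_gcd (dvd_of_mul_right_dvd hdtν) (dvd_of_mul_right_dvd hdtn))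
  · have h : d * t ∣ d * (M * c) := by
      rw [← mul_assoc, ← hNM, ← het]
      exact heNc
    exact hco.dvd_of_dvd_mul_left (Nat.dvd_of_mul_dvd_mul_left hd h)
  · exact Nat.dvd_div_of_mul_dvd hdtν
  · exact Nat.dvd_div_of_mul_dvd hdtn
  · show Nat.gcd t (N / d) = 1
    rw [Nat.div_eq_of_eq_mul_right hd hNM]
    exact hco
  · rintro ⟨d', t'⟩ ⟨hd', -, het', hdvd, -, -, -, hco'⟩
    dsimp only at hd' het' hdvd hco'
    have hdd : d = d' := by
      have h : Nat.gcd (d' * t') (d' * (N / d')) = d' := by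
        rw [Nat.gcd_mul_left, hco', mul_one]
      rwa [Nat.mul_div_cancel' (hdvd.trans (Nat.gcd_dvd_left _ _)), ← het'] at h
    rw [← hdd] at het' ⊢
    rw [Nat.eq_of_mul_eq_mul_left hd (het.symm.trans het')]
end
end
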